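/- Exactness of the master problem with all extreme-point cuts: let X = { x ∈ ℝᵈ : A x ≥ b }, f ∈ ℝᵈ, S a finite scenario set with weights p_s ≥ 0, and for each s ∈ S let Q_s(x) = inf { c_sᵀy : W_s y ≥ h_s − T_s x } with nonempty dual polyhedron Λ_s = { λ ≥ 0 : W_sᵀλ = c_s }, and assume relatively complete recourse, i.e. { y : W_s y ≥ h_s − T_s x } ≠ ∅ for every x ∈ X and s ∈ S. Then for each s there is a finite set E_s ⊆ Λ_s such that the master problem using exactly the cuts from these sets is exact: inf { fᵀx + Σ_s p_s θ_s : x ∈ X, θ_s ≥ λᵀ(h_s − T_s x) for all λ ∈ E_s, s ∈ S } = inf { fᵀx + Σ_s p_s Q_s(x) : x ∈ X }. -/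

import Mathlib

open scoped Matrix

/-- The second-stage (recourse) value function
`Q(x) = inf { cᵀ y : W y ≥ h - T x }`, with values in the extended reals
(the infimum over the empty set is `+∞`). -/
noncomputable def recourseQ {m n d : ℕ}
    (W : Matrix (Fin m) (Fin n) ℝ) (T : Matrix (Fin m) (Fin d) ℝ)
    (c : Fin n → ℝ) (h : Fin m → ℝ) (x : Fin d → ℝ) : EReal :=
  sInf ((fun y => ((c ⬝ᵥ y : ℝ) : EReal)) '' {y : Fin n → ℝ | h - T *ᵥ x ≤ W *ᵥ y})

/-- Algebraic Farkas lemma. -/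
theorem aux_farkas {V ι : Type*} [AddCommGroup V] [Module ℝ V] (s : Finset ι) :
    ∀ (a : ι → V →ₗ[ℝ] ℝ) (b : V →ₗ[ℝ] ℝ),
      (∀ x, (∀ i ∈ s, 0 ≤ a i x) → 0 ≤ b x) →
      ∃ l : ι → ℝ, (∀ i ∈ s, 0 ≤ l i) ∧ ∀ x, b x = ∑ i ∈ s, l i * a i x := by
  classical
  induction s using Finset.induction_on with
  | empty =>
    intro a b hb
    refine ⟨fun _ => 0, by simp, fun x => ?_⟩
    have h1 := hb x (by simp)
    have h2 := hb (-x) (by simp)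
    simp at h2 ⊢
    linarith
  | insert j s hj ih =>
    intro a b hb
    by_cases hcase : ∀ x, (∀ i ∈ s, 0 ≤ a i x) → 0 ≤ b x
    · obtain ⟨l, hl, hlb⟩ := ih a b hcase
      refine ⟨fun i => if i = j then 0 else l i, ?_, fun x => ?_⟩
      · intro i hi
        by_cases hij : i = j
        · simp [hij]
        · simp only [hij, if_false]
          exact hl i (Finset.mem_of_mem_insert_of_ne hi hij)
      · rw [Finset.sum_insert hj, hlb x]
        simp only [if_true, zero_mul, zero_add]
        refine Finset.sum_congr rfl fun i hi => ?_
        have : i ≠ j := fun h => hj (h ▸ hi)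
        simp [this]
    · push Not at hcase
      obtain ⟨x0, hx0, hbx0⟩ := hcase
      have hneg : a j x0 < 0 := by
        by_contra hcon
        push Not at hcon
        have := hb x0 (by
          intro i hi
          rcases Finset.mem_insert.1 hi with rfl | hi
          · exact hcon
          · exact hx0 i hi)
        linarith
      -- normalise
      obtain ⟨z, hz, hbz, hjz⟩ : ∃ z, (∀ i ∈ s, 0 ≤ a i z) ∧ b z < 0 ∧ a j z = -1 := by
        have hpos : 0 < (-(a j x0))⁻¹ := by
          apply inv_pos.2; linarith
        refine ⟨(-(a j x0))⁻¹ • x0, fun i hi => ?_, ?_, ?_⟩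
        · simp only [map_smul, smul_eq_mul]
          exact mul_nonneg hpos.le (hx0 i hi)
        · simp only [map_smul, smul_eq_mul]
          exact mul_neg_of_pos_of_neg hpos hbx0
        · simp only [map_smul, smul_eq_mul]
          have : a j x0 ≠ 0 := hneg.ne
          field_simp
      obtain ⟨l, hl, hlb⟩ := ih (fun i => a i + (a i z) • a j) (b + (b z) • a j) (by
        intro x hx
        have := hb (x + (a j x) • z) (by
          intro i hi
          rcases Finset.mem_insert.1 hi with rfl | hi
          · simp [hjz]
          · have := hx i hi
            simp at this ⊢
            linarith)
        simp at this ⊢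
        linarith)
      refine ⟨fun i => if i = j then (∑ i ∈ s, l i * a i z - b z) else l i, ?_, fun x => ?_⟩
      · intro i hi
        by_cases hij : i = j
        · simp only [hij, if_true]
          have : 0 ≤ ∑ i ∈ s, l i * a i z :=
            Finset.sum_nonneg fun i hi => mul_nonneg (hl i hi) (hz i hi)
          linarith
        · simp only [hij, if_false]
          exact hl i (Finset.mem_of_mem_insert_of_ne hi hij)
      · rw [Finset.sum_insert hj]
        have h1 : ∑ i ∈ s, (if i = j then (∑ i ∈ s, l i * a i z - b z) else l i) * a i x
            = ∑ i ∈ s, l i * a i x := by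
          refine Finset.sum_congr rfl fun i hi => ?_
          have : i ≠ j := fun h => hj (h ▸ hi)
          simp [this]
        rw [h1]
        have h2 := hlb x
        simp only [LinearMap.add_apply, LinearMap.smul_apply, smul_eq_mul, mul_add,
          Finset.sum_add_distrib] at h2
        simp only [if_true, sub_mul, Finset.sum_mul]
        have h3 : ∑ i ∈ s, l i * (a i z * a j x) = ∑ i ∈ s, l i * a i z * a j x :=
          Finset.sum_congr rfl fun i _ => by ring
        linarith

theorem aux_weak {m n : ℕ} (W : Matrix (Fin m) (Fin n) ℝ) (c : Fin n → ℝ) (g lam : Fin m → ℝ)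
    (h0 : ∀ i, 0 ≤ lam i) (h1 : Wᵀ *ᵥ lam = c) (y : Fin n → ℝ) (hy : g ≤ W *ᵥ y) :
    lam ⬝ᵥ g ≤ c ⬝ᵥ y := by
  have h2 : c ⬝ᵥ y = lam ⬝ᵥ (W *ᵥ y) := by
    rw [← h1, Matrix.mulVec_transpose, Matrix.dotProduct_mulVec]
  rw [h2]
  exact Finset.sum_le_sum fun i _ => mul_le_mul_of_nonneg_left (hy i) (h0 i)

/-- Strong duality, in the form needed. -/
theorem aux_strong {m n : ℕ} (W : Matrix (Fin m) (Fin n) ℝ) (c : Fin n → ℝ) (g : Fin m → ℝ)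
    (l0 : Fin m → ℝ) (h0 : ∀ i, 0 ≤ l0 i) (h1 : Wᵀ *ᵥ l0 = c) (r : ℝ)
    (hr : ∀ y, g ≤ W *ᵥ y → r ≤ c ⬝ᵥ y) :
    ∃ lam : Fin m → ℝ, (∀ i, 0 ≤ lam i) ∧ Wᵀ *ᵥ lam = c ∧ r ≤ lam ⬝ᵥ g := by
  classical
  let a : Option (Fin m) → ((Fin n → ℝ) × ℝ) →ₗ[ℝ] ℝ := fun o =>
    match o with
    | none => LinearMap.snd ℝ _ _
    | some i => (LinearMap.proj i ∘ₗ W.mulVecLin) ∘ₗ LinearMap.fst ℝ _ _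
        - g i • LinearMap.snd ℝ _ _
  let b : ((Fin n → ℝ) × ℝ) →ₗ[ℝ] ℝ :=
    (LinearMap.proj (0 : Fin 1) ∘ₗ (Matrix.of fun _ : Fin 1 => c).mulVecLin) ∘ₗ
      LinearMap.fst ℝ _ _ - r • LinearMap.snd ℝ _ _
  have ha : ∀ i y t, a (some i) (y, t) = (W *ᵥ y) i - g i * t := fun i y t => by simp [a]
  have ha' : ∀ y t, a none (y, t) = t := fun y t => by simp [a]
  have hbb : ∀ y t, b (y, t) = c ⬝ᵥ y - r * t := fun y t => by
    simp [b, Matrix.mulVec]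
  obtain ⟨l, hl, hlb⟩ := aux_farkas Finset.univ a b (by
    rintro ⟨y, t⟩ hx
    rw [hbb]
    have ht : 0 ≤ t := by simpa [ha'] using hx none (Finset.mem_univ _)
    have hy : ∀ i, g i * t ≤ (W *ᵥ y) i := fun i => by
      have := hx (some i) (Finset.mem_univ _)
      rw [ha] at this
      linarith
    rcases ht.eq_or_lt with rfl | ht
    · have := aux_weak W c 0 l0 h0 h1 y (fun i => by simpa using hy i)
      simpa using this
    · have := hr (t⁻¹ • y) (fun i => by
        rw [Matrix.mulVec_smul, Pi.smul_apply, smul_eq_mul, inv_mul_eq_div, le_div_iff₀ ht]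
        exact hy i)
      rw [dotProduct_smul, smul_eq_mul, inv_mul_eq_div, le_div_iff₀ ht] at this
      linarith)
  simp only [Fintype.sum_option] at hlb
  refine ⟨fun i => l (some i), fun i => hl _ (Finset.mem_univ _), ?_, ?_⟩
  · have key : ∀ y, (Wᵀ *ᵥ fun i => l (some i)) ⬝ᵥ y = c ⬝ᵥ y := fun y => by
      have := hlb (y, 0)
      simp only [hbb, ha, ha', mul_zero, sub_zero, zero_add] at this
      rw [this, Matrix.mulVec_transpose, ← Matrix.dotProduct_mulVec]
      rfl
    exact dotProduct_eq _ _ key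
  · have := hlb (0, 1)
    simp only [hbb, ha, ha', dotProduct_zero, Matrix.mulVec_zero, Pi.zero_apply, mul_one,
      zero_sub, mul_neg, Finset.sum_neg_distrib] at this
    have h3 := hl none (Finset.mem_univ _)
    change r ≤ ∑ i, l (some i) * g i
    linarith

/-- Reduction to a basic dual solution. -/
theorem aux_reduce {m n : ℕ} (W : Matrix (Fin m) (Fin n) ℝ) (c : Fin n → ℝ) (g : Fin m → ℝ)
    (y : Fin n → ℝ) (hy : g ≤ W *ᵥ y) (N : ℕ) :
    ∀ lam : Fin m → ℝ, (Finset.univ.filter fun i => lam i ≠ 0).card ≤ N →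
      (∀ i, 0 ≤ lam i) → Wᵀ *ᵥ lam = c →
      ∃ l : Fin m → ℝ, (∀ i, 0 ≤ l i) ∧ Wᵀ *ᵥ l = c ∧
        (∀ u : Fin m → ℝ, (∀ i, l i = 0 → u i = 0) → Wᵀ *ᵥ u = 0 → u = 0) ∧
        lam ⬝ᵥ g ≤ l ⬝ᵥ g := by
  classical
  induction N with
  | zero =>
    intro lam hN h0 h1
    refine ⟨lam, h0, h1, fun u hu _ => ?_, le_rfl⟩
    funext i
    apply hu
    by_contra hne
    have : i ∈ (Finset.univ.filter fun i => lam i ≠ 0) := by simp [hne]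
    rw [Finset.card_eq_zero.1 (Nat.le_zero.1 hN)] at this
    simp at this
  | succ N ih =>
    intro lam hN h0 h1
    by_cases hb : ∀ u : Fin m → ℝ, (∀ i, lam i = 0 → u i = 0) → Wᵀ *ᵥ u = 0 → u = 0
    · exact ⟨lam, h0, h1, hb, le_rfl⟩
    push Not at hb
    obtain ⟨u, hu, hWu, hune⟩ := hb
    obtain ⟨v, hv, hWv, hvg, j, hvj⟩ : ∃ v : Fin m → ℝ, (∀ i, lam i = 0 → v i = 0) ∧
        Wᵀ *ᵥ v = 0 ∧ 0 ≤ v ⬝ᵥ g ∧ ∃ j, v j < 0 := by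
      have main : ∀ v : Fin m → ℝ, v ≠ 0 → (∀ i, lam i = 0 → v i = 0) →
        Wᵀ *ᵥ v = 0 → 0 ≤ v ⬝ᵥ g → ∃ v : Fin m → ℝ, (∀ i, lam i = 0 → v i = 0) ∧
        Wᵀ *ᵥ v = 0 ∧ 0 ≤ v ⬝ᵥ g ∧ ∃ j, v j < 0 := by
        intro v hv0 hv hWv hvg
        by_cases hneg : ∃ j, v j < 0
        · exact ⟨v, hv, hWv, hvg, hneg⟩
        push Not at hneg
        have hw := aux_weak W 0 g v hneg hWv y hy
        rw [zero_dotProduct] at hw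
        refine ⟨-v, fun i hi => by simp [hv i hi], by rw [Matrix.mulVec_neg, hWv, neg_zero],
          by rw [neg_dotProduct]; linarith, ?_⟩
        by_contra hcon
        push Not at hcon
        apply hv0
        funext i
        have h2 := hcon i
        have h3 := hneg i
        simp only [Pi.neg_apply, Pi.zero_apply] at h2 ⊢
        linarith
      rcases le_total 0 (u ⬝ᵥ g) with hug | hug
      · exact main u hune hu hWu hug
      · exact main (-u) (neg_ne_zero.2 hune) (fun i hi => by simp [hu i hi])
          (by rw [Matrix.mulVec_neg, hWu, neg_zero]) (by rw [neg_dotProduct]; linarith)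
    obtain ⟨i0, hi0, hmin⟩ := Finset.exists_min_image (Finset.univ.filter fun i => v i < 0)
      (fun i => lam i / (-v i)) ⟨j, by simp [hvj]⟩
    have hvi0 : v i0 < 0 := by simpa using hi0
    set t := lam i0 / (-v i0) with ht
    have ht0 : 0 ≤ t := div_nonneg (h0 _) (by linarith)
    have hti : lam i0 + t * v i0 = 0 := by
      rw [ht]
      have : v i0 ≠ 0 := hvi0.ne
      field_simp
      ring
    obtain ⟨l, hl0, hl1, hl2, hl3⟩ := ih (lam + t • v) (by
        have hlt : (Finset.univ.filter fun i => (lam + t • v) i ≠ 0).card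
            < (Finset.univ.filter fun i => lam i ≠ 0).card := by
          apply Finset.card_lt_card
          rw [Finset.ssubset_iff_of_subset]
          · refine ⟨i0, ?_, ?_⟩
            · simp only [Finset.mem_filter, Finset.mem_univ, true_and]
              intro h
              have := hv i0 h
              linarith
            · simp [hti]
          · intro i hi
            simp only [Finset.mem_filter, Finset.mem_univ, true_and] at hi ⊢
            intro h
            apply hi
            simp [h, hv i h]
        omega)
      (by
        intro i
        simp only [Pi.add_apply, Pi.smul_apply, smul_eq_mul]
        by_cases hi : v i < 0
        · have := hmin i (by simp [hi])
          rw [le_div_iff₀ (by linarith)] at this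
          linarith
        · push Not at hi
          exact add_nonneg (h0 i) (mul_nonneg ht0 hi))
      (by rw [Matrix.mulVec_add, Matrix.mulVec_smul, hWv, smul_zero, add_zero, h1])
    refine ⟨l, hl0, hl1, hl2, le_trans ?_ hl3⟩
    rw [add_dotProduct, smul_dotProduct, smul_eq_mul]
    have := mul_nonneg ht0 hvg
    linarith

theorem aux_finite {m n : ℕ} (W : Matrix (Fin m) (Fin n) ℝ) (c : Fin n → ℝ) :
    {l : Fin m → ℝ | (∀ i, 0 ≤ l i) ∧ Wᵀ *ᵥ l = c ∧
        (∀ u : Fin m → ℝ, (∀ i, l i = 0 → u i = 0) → Wᵀ *ᵥ u = 0 → u = 0)}.Finite := by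
  classical
  apply Set.Finite.of_finite_image (f := fun l => {i | l i = 0}) (Set.toFinite _)
  rintro l ⟨_, hl1, hl2⟩ l' ⟨_, hl1', _⟩ heq
  have := hl2 (l - l') (fun i hi => by
    have h2 : i ∈ {i | l' i = 0} := by
      rw [← show {i | l i = 0} = {i | l' i = 0} from heq]
      exact hi
    have h3 : l' i = 0 := h2
    simp [hi, h3]) (by rw [Matrix.mulVec_sub, hl1, hl1', sub_self])
  exact sub_eq_zero.1 this

theorem aux_cuts {m n : ℕ} (W : Matrix (Fin m) (Fin n) ℝ) (c : Fin n → ℝ)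
    (hdual : ∃ lam : Fin m → ℝ, (∀ i, 0 ≤ lam i) ∧ Wᵀ *ᵥ lam = c) :
    ∃ E : Finset (Fin m → ℝ), (∀ lam ∈ E, (∀ i, 0 ≤ lam i) ∧ Wᵀ *ᵥ lam = c) ∧
      ∀ g : Fin m → ℝ, {y : Fin n → ℝ | g ≤ W *ᵥ y}.Nonempty →
        ∃ lam ∈ E, (∀ l ∈ E, l ⬝ᵥ g ≤ lam ⬝ᵥ g) ∧
          sInf ((fun y => ((c ⬝ᵥ y : ℝ) : EReal)) '' {y : Fin n → ℝ | g ≤ W *ᵥ y})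
            = ((lam ⬝ᵥ g : ℝ) : EReal) := by
  obtain ⟨l0, h0, h1⟩ := hdual
  have hfin := aux_finite W c
  refine ⟨hfin.toFinset, fun lam hl => ?_, ?_⟩
  · rw [Set.Finite.mem_toFinset] at hl
    exact ⟨hl.1, hl.2.1⟩
  rintro g ⟨y, hy⟩
  have hred : ∀ l : Fin m → ℝ, (∀ i, 0 ≤ l i) → Wᵀ *ᵥ l = c →
      ∃ l' ∈ hfin.toFinset, l ⬝ᵥ g ≤ l' ⬝ᵥ g := fun l hl hl' => by
    obtain ⟨l', a1, a2, a3, a4⟩ := aux_reduce W c g y hy _ l le_rfl hl hl'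
    exact ⟨l', (Set.Finite.mem_toFinset _).2 ⟨a1, a2, a3⟩, a4⟩
  obtain ⟨e, he, _⟩ := hred l0 h0 h1
  obtain ⟨lam, hlam, hmax⟩ := Finset.exists_max_image hfin.toFinset (fun l => l ⬝ᵥ g) ⟨e, he⟩
  refine ⟨lam, hlam, hmax, le_antisymm ?_ ?_⟩
  · by_contra hcon
    push Not at hcon
    obtain ⟨r, hr1, hr2⟩ := EReal.lt_iff_exists_real_btwn.1 hcon
    obtain ⟨l1, b0, b1, b2⟩ := aux_strong W c g l0 h0 h1 r (fun y hy => by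
      have h3 : sInf ((fun y => ((c ⬝ᵥ y : ℝ) : EReal)) '' {y : Fin n → ℝ | g ≤ W *ᵥ y})
        ≤ ((c ⬝ᵥ y : ℝ) : EReal) := sInf_le ⟨y, hy, rfl⟩
      exact EReal.coe_le_coe_iff.1 (hr2.le.trans h3))
    obtain ⟨l2, hl2, hle⟩ := hred l1 b0 b1
    have h4 := hmax l2 hl2
    have h5 := EReal.coe_lt_coe_iff.1 hr1
    linarith
  · apply le_sInf
    rintro _ ⟨y, hy, rfl⟩
    rw [Set.Finite.mem_toFinset] at hlam
    exact EReal.coe_le_coe_iff.2 (aux_weak W c g lam hlam.1 hlam.2.1 y hy)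

theorem aux_coe_sum {S : Type*} (s : Finset S) (F : S → ℝ) :
    ((∑ i ∈ s, F i : ℝ) : EReal) = ∑ i ∈ s, (F i : EReal) := by
  classical
  induction s using Finset.induction_on with
  | empty => simp
  | insert a s ha ih => rw [Finset.sum_insert ha, Finset.sum_insert ha, EReal.coe_add, ih]

/-- Exactness of the master problem with all extreme-point cuts: for a two-stage
stochastic linear program with first-stage feasible set `X = {x : A x ≥ b}`,
nonnegative scenario weights, nonempty scenario dual polyhedra
`Λ_s = {λ ≥ 0 : W_sᵀ λ = c_s}` and relatively complete recourse, there exist finite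
sets `E_s ⊆ Λ_s` such that the master problem using exactly the cuts
`θ_s ≥ λᵀ (h_s - T_s x)`, `λ ∈ E_s`, has the same optimal value as the two-stage
problem `inf { fᵀ x + Σ_s p_s Q_s(x) : x ∈ X }`. -/
theorem master_problem_exactness
    {k d m n : ℕ} {S : Type*} [Fintype S]
    (A : Matrix (Fin k) (Fin d) ℝ) (b : Fin k → ℝ) (f : Fin d → ℝ)
    (p : S → ℝ) (hp : ∀ s, 0 ≤ p s)
    (W : S → Matrix (Fin m) (Fin n) ℝ) (T : S → Matrix (Fin m) (Fin d) ℝ)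
    (c : S → Fin n → ℝ) (h : S → Fin m → ℝ)
    (hdual : ∀ s, ∃ lam : Fin m → ℝ, (∀ i, 0 ≤ lam i) ∧ (W s)ᵀ *ᵥ lam = c s)
    (hrcr : ∀ x : Fin d → ℝ, b ≤ A *ᵥ x →
      ∀ s, {y : Fin n → ℝ | h s - T s *ᵥ x ≤ W s *ᵥ y}.Nonempty) :
    ∃ E : S → Finset (Fin m → ℝ),
      (∀ s, ∀ lam ∈ E s, (∀ i, 0 ≤ lam i) ∧ (W s)ᵀ *ᵥ lam = c s) ∧
      sInf {v : EReal | ∃ (x : Fin d → ℝ) (θ : S → ℝ),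
          b ≤ A *ᵥ x ∧
          (∀ s, ∀ lam ∈ E s, lam ⬝ᵥ (h s - T s *ᵥ x) ≤ θ s) ∧
          v = ((f ⬝ᵥ x + ∑ s, p s * θ s : ℝ) : EReal)}
      = sInf {v : EReal | ∃ x : Fin d → ℝ,
          b ≤ A *ᵥ x ∧
          v = ((f ⬝ᵥ x : ℝ) : EReal)
              + ∑ s, ((p s : EReal) * recourseQ (W s) (T s) (c s) (h s) x)} := by
  choose E hE hcut using fun s => aux_cuts (W s) (c s) (hdual s)
  have hval : ∀ x : Fin d → ℝ, b ≤ A *ᵥ x → ∃ q : S → ℝ,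
      (∀ s, ∀ lam ∈ E s, lam ⬝ᵥ (h s - T s *ᵥ x) ≤ q s) ∧
      (∀ θ : S → ℝ, (∀ s, ∀ lam ∈ E s, lam ⬝ᵥ (h s - T s *ᵥ x) ≤ θ s) → ∀ s, q s ≤ θ s) ∧
      ((f ⬝ᵥ x : ℝ) : EReal) + ∑ s, ((p s : EReal) * recourseQ (W s) (T s) (c s) (h s) x)
        = ((f ⬝ᵥ x + ∑ s, p s * q s : ℝ) : EReal) := by
    intro x hx
    choose l hl hmax hval using fun s => hcut s (h s - T s *ᵥ x) (hrcr x hx s)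
    refine ⟨fun s => l s ⬝ᵥ (h s - T s *ᵥ x), hmax, fun θ hθ s => hθ s _ (hl s), ?_⟩
    rw [EReal.coe_add, aux_coe_sum]
    congr 1
    refine Finset.sum_congr rfl fun s _ => ?_
    rw [EReal.coe_mul, ← hval s]
    rfl
  refine ⟨E, hE, le_antisymm ?_ ?_⟩
  · apply le_sInf
    rintro v ⟨x, hx, rfl⟩
    obtain ⟨q, hq1, -, hq3⟩ := hval x hx
    exact sInf_le ⟨x, q, hx, hq1, hq3⟩
  · apply le_sInf
    rintro v ⟨x, θ, hx, hθ, rfl⟩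
    obtain ⟨q, -, hq2, hq3⟩ := hval x hx
    refine sInf_le_of_le ⟨x, hx, hq3.symm⟩ ?_
    rw [EReal.coe_le_coe_iff]
    have : ∑ s, p s * q s ≤ ∑ s, p s * θ s :=
      Finset.sum_le_sum fun s _ => mul_le_mul_of_nonneg_left (hq2 θ hθ s) (hp s)
    linarith
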